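/- arXiv:2306.13604 — 3 statements merged into one kernel-verified Lean document; each statement's English description precedes it below -/
import Mathlib

section
/- Let s1, s2, s3, s4, s5 be positive real numbers, and let (x1,y1) ≠ (x2,y2) be two points of ℂ² with all of x_k, y_k, 1−x_k, 1−y_k, y_k−x_k nonzero, each satisfying the likelihood equations s1/x − s3/(1−x) − s5/(y−x) = 0 and s2/y − s4/(1−y) + s5/(y−x) = 0, such that every solution of these equations (with the five coordinates nonzero) equals one of them, and such that det H(x_k,y_k) ≠ 0 for k = 1,2, where H(x,y) is the Hessian matrix H = [[−s1/x² − s3/(1−x)² − s5/(y−x)², s5/(y−x)²], [s5/(y−x)², −s2/y² − s4/(1−y)² − s5/(y−x)²]]. Then the sum over k = 1,2 of 1/(det H(x_k,y_k) · x_k² · (x_k−y_k)² · (1−y_k)²) equals the amplitude 1/(s1·s4) + 1/(s4·(s3+s4+s5)) + 1/((s3+s4+s5)·s5) + 1/(s5·(s1+s2+s5)) + 1/((s1+s2+s5)·s1). -/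
/-- The determinant of the Hessian of the log-likelihood function
`L = s1·log x + s2·log y + s3·log(1−x) + s4·log(1−y) + s5·log(y−x)`. -/
noncomputable def detHess (s1 s2 s3 s4 s5 : ℝ) (x y : ℂ) : ℂ :=
  (-(s1 : ℂ) / x ^ 2 - (s3 : ℂ) / (1 - x) ^ 2 - (s5 : ℂ) / (y - x) ^ 2) *
      (-(s2 : ℂ) / y ^ 2 - (s4 : ℂ) / (1 - y) ^ 2 - (s5 : ℂ) / (y - x) ^ 2) -
    ((s5 : ℂ) / (y - x) ^ 2) ^ 2

lemma pt_aux (s1 s2 s3 s4 s5 x y : ℂ)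
    (hx : x ≠ 0) (hy : y ≠ 0) (hx1 : 1 - x ≠ 0) (hy1 : 1 - y ≠ 0) (hyx : y - x ≠ 0)
    (e1 : s1 / x - s3 / (1 - x) - s5 / (y - x) = 0)
    (e2 : s2 / y - s4 / (1 - y) + s5 / (y - x) = 0) :
    (s1 - (s1 + s3) * x) * (y - x) = s5 * x * (1 - x) ∧
    (s1 - (s1 + s3) * x) * (1 - y) = (1 - x) * (s1 - (s1 + s3 + s5) * x) ∧
    (s1 - (s1 + s3) * x) * y = x * (s1 + s5 - (s1 + s3 + s5) * x) ∧
    s2 * (1 - x) * (s1 - (s1 + s3 + s5) * x) - s4 * x * (s1 + s5 - (s1 + s3 + s5) * x)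
      + (s1 + s5 - (s1 + s3 + s5) * x) * (s1 - (s1 + s3 + s5) * x) = 0 ∧
    (((-s1 / x ^ 2 - s3 / (1 - x) ^ 2 - s5 / (y - x) ^ 2) *
      (-s2 / y ^ 2 - s4 / (1 - y) ^ 2 - s5 / (y - x) ^ 2) - (s5 / (y - x) ^ 2) ^ 2)
      * x ^ 2 * (x - y) ^ 2 * (1 - y) ^ 2) *
      ((s1 - (s1 + s3) * x) * (s1 + s5 - (s1 + s3 + s5) * x)) =
      - s5 * (2 * ((s1 + s3 + s5) * (s1 + s2 + s3 + s4 + s5)) * x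
        - (s2 * (2 * s1 + s3 + s5) + s4 * (s1 + s5)
          + (s1 + s3 + s5) * (2 * s1 + s5))) * x * (1 - x) * (s1 - (s1 + s3 + s5) * x) := by
  have h1 : s1 = x * (s3 / (1 - x) + s5 / (y - x)) := by
    field_simp at e1 ⊢
    linear_combination e1
  have h2 : s2 = y * (s4 / (1 - y) - s5 / (y - x)) := by
    field_simp at e2 ⊢
    linear_combination e2
  clear e1 e2
  subst h1 h2
  refine ⟨?_, ?_, ?_, ?_, ?_⟩
  · field_simp
    ring
  · field_simp
    ring
  · field_simp
    ring
  · field_simp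
    ring
  · field_simp
    ring

lemma pf_aux (t1 t3 t5 x X B : ℂ) (h : t3 + t5 ≠ 0) (hx : x ≠ 0) (hX : X ≠ 0) (hB : B ≠ 0)
    (eX : X = 1 - x) (eB : B = t1 - (t1 + t3 + t5) * x) :
    (t1 - (t1 + t3) * x) * (t1 + t5 - (t1 + t3 + t5) * x) / (x * X * B) =
      (t1 + t5) / x - t3 ^ 2 / (t3 + t5) / X
        + t5 ^ 2 * (t1 + t3 + t5) / (t3 + t5) / B := by
  field_simp
  subst eX eB
  ring

lemma inv_aux (P M t K d x X B : ℂ) (hP : P ≠ 0) (ht : t ≠ 0) (hK : K ≠ 0) (hd : d ≠ 0)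
    (hx : x ≠ 0) (hX : X ≠ 0) (hB : B ≠ 0) (h : P * M = t * K * d * x * X * B) :
    1 / P = M / (x * X * B) * (1 / (t * K * d)) := by
  field_simp
  linear_combination -h

lemma sum_aux (a b e c t N K x1 x2 X1 X2 B1 B2 w : ℂ)
    (u1 : 1 / x1 - 1 / x2 = -(x1 - x2) * (1 / (x1 * x2)))
    (u2 : 1 / X1 - 1 / X2 = (x1 - x2) * (1 / (X1 * X2)))
    (u3 : 1 / B1 - 1 / B2 = (x1 - x2) * (c * (1 / (B1 * B2))))
    (hd : (x1 - x2) * w = 1 / t * (1 / K)) (hc : 1 / N = c * (1 / K)) :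
    (a / x1 - b / X1 + e / B1) * -w + (a / x2 - b / X2 + e / B2) * w =
      1 / t * (a / (K * (x1 * x2)) + b / (K * (X1 * X2)) - e / (N * (B1 * B2))) := by
  linear_combination (-a * u1 + b * u2 - e * u3) * w
      + (a * (1 / (x1 * x2)) + b * (1 / (X1 * X2)) - e * (c * (1 / (B1 * B2)))) * hd
      + 1 / t * e * (1 / (B1 * B2)) * hc

/-- CHY formula for the 5-point amplitude: if the likelihood equations have exactly the
two solutions `(x1,y1) ≠ (x2,y2)` (with nondegenerate Hessians), then the sum of
`1/(det H · x²(x−y)²(1−y)²)` over the two critical points equals the amplitude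
`1/(s1s4) + 1/(s4(s3+s4+s5)) + 1/((s3+s4+s5)s5) + 1/(s5(s1+s2+s5)) + 1/((s1+s2+s5)s1)`. -/
theorem stmt7 (s1 s2 s3 s4 s5 : ℝ)
    (h1 : 0 < s1) (h2 : 0 < s2) (h3 : 0 < s3) (h4 : 0 < s4) (h5 : 0 < s5)
    (x1 y1 x2 y2 : ℂ)
    (hne : (x1, y1) ≠ (x2, y2))
    (hdom1 : x1 ≠ 0 ∧ y1 ≠ 0 ∧ 1 - x1 ≠ 0 ∧ 1 - y1 ≠ 0 ∧ y1 - x1 ≠ 0)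
    (hdom2 : x2 ≠ 0 ∧ y2 ≠ 0 ∧ 1 - x2 ≠ 0 ∧ 1 - y2 ≠ 0 ∧ y2 - x2 ≠ 0)
    (heq1 : (s1 : ℂ) / x1 - (s3 : ℂ) / (1 - x1) - (s5 : ℂ) / (y1 - x1) = 0 ∧
      (s2 : ℂ) / y1 - (s4 : ℂ) / (1 - y1) + (s5 : ℂ) / (y1 - x1) = 0)
    (heq2 : (s1 : ℂ) / x2 - (s3 : ℂ) / (1 - x2) - (s5 : ℂ) / (y2 - x2) = 0 ∧
      (s2 : ℂ) / y2 - (s4 : ℂ) / (1 - y2) + (s5 : ℂ) / (y2 - x2) = 0)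
    (hall : ∀ x y : ℂ, x ≠ 0 → y ≠ 0 → 1 - x ≠ 0 → 1 - y ≠ 0 → y - x ≠ 0 →
      (s1 : ℂ) / x - (s3 : ℂ) / (1 - x) - (s5 : ℂ) / (y - x) = 0 →
      (s2 : ℂ) / y - (s4 : ℂ) / (1 - y) + (s5 : ℂ) / (y - x) = 0 →
      (x, y) = (x1, y1) ∨ (x, y) = (x2, y2))
    (hH1 : detHess s1 s2 s3 s4 s5 x1 y1 ≠ 0)
    (hH2 : detHess s1 s2 s3 s4 s5 x2 y2 ≠ 0) :
    1 / (detHess s1 s2 s3 s4 s5 x1 y1 * x1 ^ 2 * (x1 - y1) ^ 2 * (1 - y1) ^ 2) +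
      1 / (detHess s1 s2 s3 s4 s5 x2 y2 * x2 ^ 2 * (x2 - y2) ^ 2 * (1 - y2) ^ 2) =
    1 / ((s1 : ℂ) * s4) + 1 / ((s4 : ℂ) * (s3 + s4 + s5)) +
      1 / (((s3 : ℂ) + s4 + s5) * s5) + 1 / ((s5 : ℂ) * (s1 + s2 + s5)) +
      1 / (((s1 : ℂ) + s2 + s5) * s1) := by
  have c1 : (s1 : ℂ) ≠ 0 := by exact_mod_cast h1.ne'
  have c3 : (s3 : ℂ) ≠ 0 := by exact_mod_cast h3.ne'
  have c4 : (s4 : ℂ) ≠ 0 := by exact_mod_cast h4.ne'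
  have c5 : (s5 : ℂ) ≠ 0 := by exact_mod_cast h5.ne'
  have c35 : (s3 : ℂ) + s5 ≠ 0 := by exact_mod_cast (by positivity : s3 + s5 ≠ 0)
  have c135 : (s1 : ℂ) + s3 + s5 ≠ 0 := by exact_mod_cast (by positivity : s1 + s3 + s5 ≠ 0)
  have c345 : (s3 : ℂ) + s4 + s5 ≠ 0 := by exact_mod_cast (by positivity : s3 + s4 + s5 ≠ 0)
  have c125 : (s1 : ℂ) + s2 + s5 ≠ 0 := by exact_mod_cast (by positivity : s1 + s2 + s5 ≠ 0)
  have call : (s1 : ℂ) + s2 + s3 + s4 + s5 ≠ 0 := by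
    exact_mod_cast (by positivity : s1 + s2 + s3 + s4 + s5 ≠ 0)
  obtain ⟨a1, a2, a3, a4, a5⟩ := hdom1
  obtain ⟨b1, b2, b3, b4, b5⟩ := hdom2
  obtain ⟨p1, p2, p3, p4, p5⟩ :=
    pt_aux s1 s2 s3 s4 s5 x1 y1 a1 a2 a3 a4 a5 heq1.1 heq1.2
  obtain ⟨q1, q2, q3, q4, q5⟩ :=
    pt_aux s1 s2 s3 s4 s5 x2 y2 b1 b2 b3 b4 b5 heq2.1 heq2.2
  change detHess s1 s2 s3 s4 s5 x1 y1 * _ * _ * _ * _ = _ at p5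
  change detHess s1 s2 s3 s4 s5 x2 y2 * _ * _ * _ * _ = _ at q5
  have a6 : x1 - y1 ≠ 0 := by rw [← neg_sub]; exact neg_ne_zero.mpr a5
  have b6 : x2 - y2 ≠ 0 := by rw [← neg_sub]; exact neg_ne_zero.mpr b5
  have E1 : detHess s1 s2 s3 s4 s5 x1 y1 * x1 ^ 2 * (x1 - y1) ^ 2 * (1 - y1) ^ 2 ≠ 0 := by
    positivity
  have E2 : detHess s1 s2 s3 s4 s5 x2 y2 * x2 ^ 2 * (x2 - y2) ^ 2 * (1 - y2) ^ 2 ≠ 0 := by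
    positivity
  generalize detHess s1 s2 s3 s4 s5 x1 y1 * x1 ^ 2 * (x1 - y1) ^ 2 * (1 - y1) ^ 2 = P at *
  generalize detHess s1 s2 s3 s4 s5 x2 y2 * x2 ^ 2 * (x2 - y2) ^ 2 * (1 - y2) ^ 2 = Q at *
  clear hall hH1 hH2 heq1 heq2
  generalize (s1 : ℂ) = t1 at *
  generalize (s2 : ℂ) = t2 at *
  generalize (s3 : ℂ) = t3 at *
  generalize (s4 : ℂ) = t4 at *
  generalize (s5 : ℂ) = t5 at *
  have D1 : t1 - (t1 + t3) * x1 ≠ 0 := by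
    intro h; rw [h, zero_mul] at p1; exact mul_ne_zero (mul_ne_zero c5 a1) a3 p1.symm
  have D2 : t1 - (t1 + t3) * x2 ≠ 0 := by
    intro h; rw [h, zero_mul] at q1; exact mul_ne_zero (mul_ne_zero c5 b1) b3 q1.symm
  have B1 : t1 - (t1 + t3 + t5) * x1 ≠ 0 := by
    intro h; rw [h, mul_zero] at p2; exact mul_ne_zero D1 a4 p2
  have B2 : t1 - (t1 + t3 + t5) * x2 ≠ 0 := by
    intro h; rw [h, mul_zero] at q2; exact mul_ne_zero D2 b4 q2
  have A1 : t1 + t5 - (t1 + t3 + t5) * x1 ≠ 0 := by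
    intro h; rw [h, mul_zero] at p3; exact mul_ne_zero D1 a2 p3
  have A2 : t1 + t5 - (t1 + t3 + t5) * x2 ≠ 0 := by
    intro h; rw [h, mul_zero] at q3; exact mul_ne_zero D2 b2 q3
  have hx : x1 - x2 ≠ 0 := by
    intro h
    have h' : x1 = x2 := sub_eq_zero.mp h
    subst h'
    exact hne (Prod.ext rfl (mul_left_cancel₀ D1 (p3.trans q3.symm)))
  -- Vieta
  have V1 : (t1 + t3 + t5) * (t1 + t2 + t3 + t4 + t5) * (x1 + x2) =
      t2 * (2 * t1 + t3 + t5) + t4 * (t1 + t5) + (t1 + t3 + t5) * (2 * t1 + t5) := by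
    apply mul_left_cancel₀ hx
    linear_combination p4 - q4
  have V2 : (t1 + t3 + t5) * (t1 + t2 + t3 + t4 + t5) * (x1 * x2) = t1 * (t1 + t2 + t5) := by
    linear_combination x1 * V1 - p4
  have P1 : P * ((t1 - (t1 + t3) * x1) * (t1 + t5 - (t1 + t3 + t5) * x1)) =
      - t5 * ((t1 + t3 + t5) * (t1 + t2 + t3 + t4 + t5)) * (x1 - x2) * x1 * (1 - x1) *
        (t1 - (t1 + t3 + t5) * x1) := by
    rw [p5, ← V1]; ring
  have Q1 : Q * ((t1 - (t1 + t3) * x2) * (t1 + t5 - (t1 + t3 + t5) * x2)) =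
      t5 * ((t1 + t3 + t5) * (t1 + t2 + t3 + t4 + t5)) * (x1 - x2) * x2 * (1 - x2) *
        (t1 - (t1 + t3 + t5) * x2) := by
    rw [q5, ← V1]; ring
  have V3 : (t1 + t3 + t5) * (t1 + t2 + t3 + t4 + t5) * ((1 - x1) * (1 - x2)) =
      t3 * (t3 + t4 + t5) := by
    linear_combination V2 - V1
  have V4 : (t1 + t2 + t3 + t4 + t5) *
      ((t1 - (t1 + t3 + t5) * x1) * (t1 - (t1 + t3 + t5) * x2)) = - t1 * t4 * t5 := by
    apply mul_left_cancel₀ c135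
    linear_combination (t1 + t3 + t5) ^ 2 * V2 - t1 * (t1 + t3 + t5) * V1
  set K := (t1 + t3 + t5) * (t1 + t2 + t3 + t4 + t5) with hK
  have K0 : K ≠ 0 := mul_ne_zero c135 call
  have T1 := inv_aux P _ (-t5) K (x1 - x2) x1 (1 - x1) _ E1 (neg_ne_zero.mpr c5) K0 hx a1 a3 B1 P1
  have T2 := inv_aux Q _ t5 K (x1 - x2) x2 (1 - x2) _ E2 c5 K0 hx b1 b3 B2 Q1
  rw [pf_aux t1 t3 t5 x1 _ _ c35 a1 a3 B1 rfl rfl] at T1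
  rw [pf_aux t1 t3 t5 x2 _ _ c35 b1 b3 B2 rfl rfl] at T2
  have hn : 1 / (-t5 * K * (x1 - x2)) = -(1 / (t5 * K * (x1 - x2))) := by
    rw [neg_mul, neg_mul, one_div_neg_eq_neg_one_div]
  have u1 : 1 / x1 - 1 / x2 = -(x1 - x2) * (1 / (x1 * x2)) := by field_simp; ring
  have u2 : 1 / (1 - x1) - 1 / (1 - x2) = (x1 - x2) * (1 / ((1 - x1) * (1 - x2))) := by
    field_simp; ring
  have u3 : 1 / (t1 - (t1 + t3 + t5) * x1) - 1 / (t1 - (t1 + t3 + t5) * x2) =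
      (x1 - x2) * ((t1 + t3 + t5) * (1 / ((t1 - (t1 + t3 + t5) * x1) *
        (t1 - (t1 + t3 + t5) * x2)))) := by
    have g : ∀ a b k : ℂ, a ≠ 0 → b ≠ 0 → b - a = k → 1 / a - 1 / b = k * (1 / (a * b)) := by
      intro a b k ha hb h; subst h; field_simp
    rw [g _ _ ((x1 - x2) * (t1 + t3 + t5)) B1 B2 (by ring)]; ring
  have hc : 1 / (t1 + t2 + t3 + t4 + t5) = (t1 + t3 + t5) * (1 / K) := by
    rw [hK]; field_simp
  clear_value K
  have hd : (x1 - x2) * (1 / (t5 * K * (x1 - x2))) = 1 / t5 * (1 / K) := by field_simp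
  rw [T1, T2, hn, sum_aux _ _ _ _ _ _ K _ _ _ _ _ _ _ u1 u2 u3 hd hc, V2, V3, V4]
  clear * - c1 c3 c4 c5 c35 c345 c125
  field_simp
  ring
end

section
/- Let M be a 3×6 complex matrix with columns v1,...,v6 ∈ ℂ³, and suppose every 3×3 minor of M is nonzero. Then there exists a nonzero quadratic form Q on ℂ³ (equivalently, a nonzero symmetric 3×3 complex matrix A, with Q(v) = vᵀAv) such that Q(v_j) = 0 for all j = 1,...,6, if and only if q = 0, where q = p134·p156·p235·p246 − p135·p146·p234·p256 and p_{ijk} denotes the determinant of the 3×3 submatrix of M formed by columns i, j, k. -/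
open Matrix

/-- The 3×3 minor of a 3×6 matrix on columns `i`, `j`, `k`. -/
noncomputable def minor3 (M : Matrix (Fin 3) (Fin 6) ℂ) (i j k : Fin 6) : ℂ :=
  (M.submatrix id ![i, j, k]).det

theorem quad_eq (M : Matrix (Fin 3) (Fin 6) ℂ) (A : Matrix (Fin 3) (Fin 3) ℂ) (l : Fin 6) :
    ∑ r : Fin 3, ∑ c : Fin 3, M r l * A r c * M c l = (Mᵀ * A * M) l l := by
  simp only [Matrix.mul_apply, Fin.sum_univ_three, Matrix.transpose_apply]
  ring

theorem minor3_mul (P : Matrix (Fin 3) (Fin 3) ℂ) (N : Matrix (Fin 3) (Fin 6) ℂ) (i j k : Fin 6) :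
    minor3 (P * N) i j k = P.det * minor3 N i j k := by
  unfold minor3
  rw [← Matrix.det_mul]
  congr 1

theorem core (N : Matrix (Fin 3) (Fin 6) ℂ) (hN : N.submatrix id ![0, 1, 2] = 1) :
    (∃ A : Matrix (Fin 3) (Fin 3) ℂ, A.IsSymm ∧ A ≠ 0 ∧
        ∀ l : Fin 6, ∑ r : Fin 3, ∑ c : Fin 3, N r l * A r c * N c l = 0) ↔
      minor3 N 0 2 3 * minor3 N 0 4 5 * minor3 N 1 2 4 * minor3 N 1 3 5 -
        minor3 N 0 2 4 * minor3 N 0 3 5 * minor3 N 1 2 3 * minor3 N 1 4 5 = 0 := by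
  have h00 : N 0 0 = 1 := by simpa using congrFun (congrFun hN 0) 0
  have h10 : N 1 0 = 0 := by simpa using congrFun (congrFun hN 1) 0
  have h20 : N 2 0 = 0 := by simpa using congrFun (congrFun hN 2) 0
  have h01 : N 0 1 = 0 := by simpa using congrFun (congrFun hN 0) 1
  have h11 : N 1 1 = 1 := by simpa using congrFun (congrFun hN 1) 1
  have h21 : N 2 1 = 0 := by simpa using congrFun (congrFun hN 2) 1
  have h02 : N 0 2 = 0 := by simpa using congrFun (congrFun hN 0) 2
  have h12 : N 1 2 = 0 := by simpa using congrFun (congrFun hN 1) 2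
  have h22 : N 2 2 = 1 := by simpa using congrFun (congrFun hN 2) 2
  let D : Matrix (Fin 3) (Fin 3) ℂ :=
    !![N 1 3 * N 2 3, N 0 3 * N 2 3, N 0 3 * N 1 3;
       N 1 4 * N 2 4, N 0 4 * N 2 4, N 0 4 * N 1 4;
       N 1 5 * N 2 5, N 0 5 * N 2 5, N 0 5 * N 1 5]
  have hq : minor3 N 0 2 3 * minor3 N 0 4 5 * minor3 N 1 2 4 * minor3 N 1 3 5 -
        minor3 N 0 2 4 * minor3 N 0 3 5 * minor3 N 1 2 3 * minor3 N 1 4 5 = D.det := by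
    simp [minor3, Matrix.det_fin_three, D, h00, h10, h20, h01, h11, h21, h02, h12, h22]
    ring
  rw [hq, ← Matrix.exists_mulVec_eq_zero_iff]
  constructor
  · rintro ⟨A, hs, hA, h⟩
    have e0 := h 0
    have e1 := h 1
    have e2 := h 2
    have e3 := h 3
    have e4 := h 4
    have e5 := h 5
    have s01 := hs.apply 0 1
    have s02 := hs.apply 0 2
    have s12 := hs.apply 1 2
    simp [Fin.sum_univ_three, h00, h10, h20] at e0
    simp [Fin.sum_univ_three, h01, h11, h21] at e1
    simp [Fin.sum_univ_three, h02, h12, h22] at e2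
    simp only [Fin.sum_univ_three, e0, e1, e2, s01, s02, s12] at e3 e4 e5
    refine ⟨![A 1 2, A 0 2, A 0 1], ?_, ?_⟩
    · intro hz
      apply hA
      have z0 : A 1 2 = 0 := by simpa using congrFun hz 0
      have z1 : A 0 2 = 0 := by simpa using congrFun hz 1
      have z2 : A 0 1 = 0 := by simpa using congrFun hz 2
      ext i j
      fin_cases i <;> fin_cases j <;> simp [*]
    · ext i
      fin_cases i <;> simp [D, Matrix.mulVec, dotProduct, Fin.sum_univ_three]
      · linear_combination e3 / 2
      · linear_combination e4 / 2
      · linear_combination e5 / 2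
  · rintro ⟨v, hv, h⟩
    have e3 := congrFun h 0
    have e4 := congrFun h 1
    have e5 := congrFun h 2
    simp [D, Matrix.mulVec, dotProduct, Fin.sum_univ_three] at e3 e4 e5
    refine ⟨!![0, v 2, v 1; v 2, 0, v 0; v 1, v 0, 0], ?_, ?_, ?_⟩
    · ext i j
      fin_cases i <;> fin_cases j <;> simp
    · intro hz
      apply hv
      have z0 : v 0 = 0 := by simpa using congrFun (congrFun hz 1) 2
      have z1 : v 1 = 0 := by simpa using congrFun (congrFun hz 0) 2
      have z2 : v 2 = 0 := by simpa using congrFun (congrFun hz 0) 1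
      ext i
      fin_cases i <;> simp [*]
    · intro l
      fin_cases l <;> simp [Fin.sum_univ_three, h00, h10, h20, h01, h11, h21, h02, h12, h22]
      · linear_combination 2 * e3
      · linear_combination 2 * e4
      · linear_combination 2 * e5

theorem transfer (P : Matrix (Fin 3) (Fin 3) ℂ) (hP : IsUnit P.det)
    (N : Matrix (Fin 3) (Fin 6) ℂ)
    (h : ∃ A : Matrix (Fin 3) (Fin 3) ℂ, A.IsSymm ∧ A ≠ 0 ∧
        ∀ l : Fin 6, ∑ r : Fin 3, ∑ c : Fin 3, (P * N) r l * A r c * (P * N) c l = 0) :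
    ∃ A : Matrix (Fin 3) (Fin 3) ℂ, A.IsSymm ∧ A ≠ 0 ∧
        ∀ l : Fin 6, ∑ r : Fin 3, ∑ c : Fin 3, N r l * A r c * N c l = 0 := by
  obtain ⟨A, hs, hA, h⟩ := h
  refine ⟨Pᵀ * A * P, ?_, ?_, ?_⟩
  · unfold Matrix.IsSymm
    rw [Matrix.transpose_mul, Matrix.transpose_mul, hs.eq, Matrix.transpose_transpose,
      Matrix.mul_assoc]
  · intro hz
    apply hA
    have hPt : IsUnit Pᵀ.det := by rwa [Matrix.det_transpose]
    calc A = (Pᵀ)⁻¹ * (Pᵀ * A * P) * P⁻¹ := by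
            rw [Matrix.mul_assoc Pᵀ, Matrix.nonsing_inv_mul_cancel_left _ _ hPt,
              Matrix.mul_nonsing_inv_cancel_right _ _ hP]
      _ = 0 := by rw [hz]; simp
  · intro l
    have := h l
    rw [quad_eq] at this ⊢
    rw [← this, Matrix.transpose_mul]
    simp only [Matrix.mul_assoc]

/-- Let `M` be a 3×6 complex matrix all of whose 3×3 minors are nonzero. There exists a
nonzero symmetric 3×3 matrix `A` (a nonzero quadratic form) vanishing on all six columns
of `M` if and only if the Plücker binomial
`q = p134·p156·p235·p246 − p135·p146·p234·p256` vanishes. -/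
theorem stmt8 (M : Matrix (Fin 3) (Fin 6) ℂ)
    (hminor : ∀ i j k : Fin 6, i < j → j < k → minor3 M i j k ≠ 0) :
    (∃ A : Matrix (Fin 3) (Fin 3) ℂ, A.IsSymm ∧ A ≠ 0 ∧
        ∀ l : Fin 6, ∑ r : Fin 3, ∑ c : Fin 3, M r l * A r c * M c l = 0) ↔
      minor3 M 0 2 3 * minor3 M 0 4 5 * minor3 M 1 2 4 * minor3 M 1 3 5 -
        minor3 M 0 2 4 * minor3 M 0 3 5 * minor3 M 1 2 3 * minor3 M 1 4 5 = 0 := by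
  have hd : (M.submatrix id ![0, 1, 2]).det ≠ 0 := hminor 0 1 2 (by decide) (by decide)
  set P := M.submatrix id ![0, 1, 2] with hPdef
  have hP : IsUnit P.det := isUnit_iff_ne_zero.mpr hd
  have hPi : IsUnit (P⁻¹).det := Matrix.isUnit_nonsing_inv_det P hP
  obtain ⟨N, hN⟩ : ∃ N, N = P⁻¹ * M := ⟨_, rfl⟩
  have hM : M = P * N := by rw [hN, Matrix.mul_nonsing_inv_cancel_left _ _ hP]
  have hN1 : N.submatrix id ![0, 1, 2] = 1 := by
    have : N.submatrix id ![0, 1, 2] = P⁻¹ * P := by rw [hN, hPdef]; rfl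
    rw [this, Matrix.nonsing_inv_mul _ hP]
  have key := core N hN1
  clear_value P
  have hE := Iff.intro (fun h => transfer P hP N h)
    (fun h => transfer P⁻¹ hPi (P * N) (by rwa [Matrix.nonsing_inv_mul_cancel_left _ _ hP]))
  rw [hM, hE, key]
  simp only [minor3_mul]
  constructor
  · intro h
    linear_combination P.det ^ 4 * h
  · intro h
    refine (mul_eq_zero.mp ?_).resolve_left (pow_ne_zero 4 hd)
    linear_combination h
end

section
/- Let v1,...,v15 ∈ ℝ⁴ be the columns of the 4×15 matrix [[4,−4,2,2,−4,−4,0,2,−4,2,−1,4,−2,0,−2],[0,−4,−4,2,4,2,−4,2,2,−4,−1,−1,0,4,0],[0,0,4,−4,0,−4,0,4,4,−4,0,0,4,0,−4],[0,0,0,4,3,−4,4,4,−4,0,−3,3,1,0,1]]. Then for a 4-element subset S ⊆ {1,...,15}, there exists an affine functional f : ℝ⁴ → ℝ with f(v_i) = 0 for all i ∈ S and f(v_j) > 0 for all j ∉ S, if and only if S is one of the following 45 quadruples: {1,3,8,9},{1,3,8,12},{1,3,9,11},{1,3,10,11},{1,3,10,12},{1,4,6,10},{1,4,6,14},{1,4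,8,12},{1,4,8,14},{1,4,10,12},{1,6,9,11},{1,6,9,14},{1,6,10,11},{1,8,9,14},{2,3,7,10},{2,3,7,13},{2,3,9,11},{2,3,9,13},{2,3,10,11},{2,5,6,9},{2,5,6,15},{2,5,7,13},{2,5,7,15},{2,5,9,13},{2,6,9,11},{2,6,10,11},{2,6,10,15},{2,7,10,15},{3,7,8,12},{3,7,8,13},{3,7,10,12},{3,8,9,13},{4,5,6,14},{4,5,6,15},{4,5,7,8},{4,5,7,15},{4,5,8,14},{4,6,10,15},{4,7,8,12},{4,7,10,12},{4,7,10,15},{5,6,9,14},{5,7,8,13},{5,8,9,13},{5,8,9,14}. In particular, the convex hull of v1,...,v15 is a simplicial 4-polytope with 15 vertices whose 45 facets are exactly these quadruples. -/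
open Matrix

/-- The 4×15 matrix whose columns `v_1, …, v_15` realize the `E6` pezzotope. -/
def VE6 : Matrix (Fin 4) (Fin 15) ℝ :=
  !![4, -4, 2, 2, -4, -4, 0, 2, -4, 2, -1, 4, -2, 0, -2;
     0, -4, -4, 2, 4, 2, -4, 2, 2, -4, -1, -1, 0, 4, 0;
     0, 0, 4, -4, 0, -4, 0, 4, 4, -4, 0, 0, 4, 0, -4;
     0, 0, 0, 4, 3, -4, 4, 4, -4, 0, -3, 3, 1, 0, 1]

/-- The 45 facet quadruples (0-based: vertex `i` stands for `v_{i+1}`). -/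
def facetsE6 : Finset (Finset (Fin 15)) :=
  {{0, 2, 7, 8}, {0, 2, 7, 11}, {0, 2, 8, 10}, {0, 2, 9, 10}, {0, 2, 9, 11},
   {0, 3, 5, 9}, {0, 3, 5, 13}, {0, 3, 7, 11}, {0, 3, 7, 13}, {0, 3, 9, 11},
   {0, 5, 8, 10}, {0, 5, 8, 13}, {0, 5, 9, 10}, {0, 7, 8, 13}, {1, 2, 6, 9},
   {1, 2, 6, 12}, {1, 2, 8, 10}, {1, 2, 8, 12}, {1, 2, 9, 10}, {1, 4, 5, 8},
   {1, 4, 5, 14}, {1, 4, 6, 12}, {1, 4, 6, 14}, {1, 4, 8, 12}, {1, 5, 8, 10},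
   {1, 5, 9, 10}, {1, 5, 9, 14}, {1, 6, 9, 14}, {2, 6, 7, 11}, {2, 6, 7, 12},
   {2, 6, 9, 11}, {2, 7, 8, 12}, {3, 4, 5, 13}, {3, 4, 5, 14}, {3, 4, 6, 7},
   {3, 4, 6, 14}, {3, 4, 7, 13}, {3, 5, 9, 14}, {3, 6, 7, 11}, {3, 6, 9, 11},
   {3, 6, 9, 14}, {4, 5, 8, 13}, {4, 6, 7, 12}, {4, 7, 8, 12}, {4, 7, 8, 13}}


/-- Integer coordinates, packed as hexadecimal digits shifted by 4. -/
def dig (N i : ℕ) : ℤ := Int.subNatNat (Nat.mod (Nat.div N (Nat.pow 16 i)) 16) 4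
def cX (i : ℕ) : ℤ := dig 162836986556605960 i
def cY (i : ℕ) : ℤ := dig 325441175557791748 i
def cZ (i : ℕ) : ℤ := dig 20341001688451140 i
def cW (i : ℕ) : ℤ := dig 379834265556714564 i

/-- 3×3 determinant. -/
def d3 {R : Type*} [Mul R] [Add R] [Sub R] (a b c d e f g h i : R) : R :=
  a * (e * i - f * h) - b * (d * i - f * g) + c * (d * h - e * g)

def nX (i j k l : ℕ) : ℤ :=
  - d3 (cY j - cY i) (cZ j - cZ i) (cW j - cW i) (cY k - cY i) (cZ k - cZ i) (cW k - cW i)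
    (cY l - cY i) (cZ l - cZ i) (cW l - cW i)
def nY (i j k l : ℕ) : ℤ :=
  d3 (cX j - cX i) (cZ j - cZ i) (cW j - cW i) (cX k - cX i) (cZ k - cZ i) (cW k - cW i)
    (cX l - cX i) (cZ l - cZ i) (cW l - cW i)
def nZ (i j k l : ℕ) : ℤ :=
  - d3 (cX j - cX i) (cY j - cY i) (cW j - cW i) (cX k - cX i) (cY k - cY i) (cW k - cW i)
    (cX l - cX i) (cY l - cY i) (cW l - cW i)
def nW (i j k l : ℕ) : ℤ :=
  d3 (cX j - cX i) (cY j - cY i) (cZ j - cZ i) (cX k - cX i) (cY k - cY i) (cZ k - cZ i)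
    (cX l - cX i) (cY l - cY i) (cZ l - cZ i)

/-- Signed volume of the points `i j k l m`. -/
def dd (i j k l m : ℕ) : ℤ :=
  nX i j k l * (cX m - cX i) + nY i j k l * (cY m - cY i) + nZ i j k l * (cZ m - cZ i)
    + nW i j k l * (cW m - cW i)

def fl : List (Fin 15 × Fin 15 × Fin 15 × Fin 15) :=
  [(0, 2, 7, 8), (0, 2, 7, 11), (0, 2, 8, 10), (0, 2, 9, 10), (0, 2, 9, 11),
   (0, 3, 5, 9), (0, 3, 5, 13), (0, 3, 7, 11), (0, 3, 7, 13), (0, 3, 9, 11),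
   (0, 5, 8, 10), (0, 5, 8, 13), (0, 5, 9, 10), (0, 7, 8, 13), (1, 2, 6, 9),
   (1, 2, 6, 12), (1, 2, 8, 10), (1, 2, 8, 12), (1, 2, 9, 10), (1, 4, 5, 8),
   (1, 4, 5, 14), (1, 4, 6, 12), (1, 4, 6, 14), (1, 4, 8, 12), (1, 5, 8, 10),
   (1, 5, 9, 10), (1, 5, 9, 14), (1, 6, 9, 14), (2, 6, 7, 11), (2, 6, 7, 12),
   (2, 6, 9, 11), (2, 7, 8, 12), (3, 4, 5, 13), (3, 4, 5, 14), (3, 4, 6, 7),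
   (3, 4, 6, 14), (3, 4, 7, 13), (3, 5, 9, 14), (3, 6, 7, 11), (3, 6, 9, 11),
   (3, 6, 9, 14), (4, 5, 8, 13), (4, 6, 7, 12), (4, 7, 8, 12), (4, 7, 8, 13)]

def dl : List (Fin 15 × Fin 15 × Fin 15 × Fin 15) :=
  [(0, 1, 6, 10), (1, 3, 8, 13), (1, 5, 7, 13), (2, 3, 7, 9), (2, 5, 8, 9), (2, 9, 12, 14), (3, 5, 7, 8), (3, 7, 12, 14), (5, 8, 12, 14)]

def q4 (t : Fin 15 × Fin 15 × Fin 15 × Fin 15) : Finset (Fin 15) := {t.1, t.2.1, t.2.2.1, t.2.2.2}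

def flN : List (ℕ × ℕ × ℕ × ℕ) :=
  [(0, 2, 7, 8), (0, 2, 7, 11), (0, 2, 8, 10), (0, 2, 9, 10), (0, 2, 9, 11),
   (0, 3, 5, 9), (0, 3, 5, 13), (0, 3, 7, 11), (0, 3, 7, 13), (0, 3, 9, 11),
   (0, 5, 8, 10), (0, 5, 8, 13), (0, 5, 9, 10), (0, 7, 8, 13), (1, 2, 6, 9),
   (1, 2, 6, 12), (1, 2, 8, 10), (1, 2, 8, 12), (1, 2, 9, 10), (1, 4, 5, 8),
   (1, 4, 5, 14), (1, 4, 6, 12), (1, 4, 6, 14), (1, 4, 8, 12), (1, 5, 8, 10),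
   (1, 5, 9, 10), (1, 5, 9, 14), (1, 6, 9, 14), (2, 6, 7, 11), (2, 6, 7, 12),
   (2, 6, 9, 11), (2, 7, 8, 12), (3, 4, 5, 13), (3, 4, 5, 14), (3, 4, 6, 7),
   (3, 4, 6, 14), (3, 4, 7, 13), (3, 5, 9, 14), (3, 6, 7, 11), (3, 6, 9, 11),
   (3, 6, 9, 14), (4, 5, 8, 13), (4, 6, 7, 12), (4, 7, 8, 12), (4, 7, 8, 13)]

def dlN : List (ℕ × ℕ × ℕ × ℕ) :=
  [(0, 1, 6, 10), (1, 3, 8, 13), (1, 5, 7, 13), (2, 3, 7, 9), (2, 5, 8, 9), (2, 9, 12, 14), (3, 5, 7, 8), (3, 7, 12, 14), (5, 8, 12, 14)]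

def toN (t : Fin 15 × Fin 15 × Fin 15 × Fin 15) : ℕ × ℕ × ℕ × ℕ :=
  (t.1.val, t.2.1.val, t.2.2.1.val, t.2.2.2.val)

theorem toN_inj : Function.Injective toN := by
  rintro ⟨a, b, c, d⟩ ⟨a', b', c', d'⟩ h
  simp only [toN, Prod.mk.injEq, Fin.val_inj] at h
  obtain ⟨rfl, rfl, rfl, rfl⟩ := h
  rfl

theorem flN_eq : flN = fl.map toN := by rfl
theorem dlN_eq : dlN = dl.map toN := by rfl

def memB (L : List (ℕ × ℕ × ℕ × ℕ)) (i j k l : ℕ) : Bool :=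
  L.any fun t => Nat.beq t.1 i && (Nat.beq t.2.1 j && (Nat.beq t.2.2.1 k && Nat.beq t.2.2.2 l))

theorem memB_iff (L : List (ℕ × ℕ × ℕ × ℕ)) (i j k l : ℕ) :
    memB L i j k l = true ↔ (i, j, k, l) ∈ L := by
  simp only [memB, List.any_eq_true, Bool.and_eq_true]
  constructor
  · rintro ⟨⟨a, b, c, d⟩, h, h1, h2, h3, h4⟩
    obtain rfl := Nat.eq_of_beq_eq_true h1
    obtain rfl := Nat.eq_of_beq_eq_true h2
    obtain rfl := Nat.eq_of_beq_eq_true h3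
    obtain rfl := Nat.eq_of_beq_eq_true h4
    exact h
  · intro h
    exact ⟨_, h, Nat.beq_refl _, Nat.beq_refl _, Nat.beq_refl _, Nat.beq_refl _⟩

def allB : ℕ → (ℕ → Bool) → Bool
  | 0, _ => true
  | n + 1, f => f n && allB n f

def anyB : ℕ → (ℕ → Bool) → Bool
  | 0, _ => false
  | n + 1, f => f n || anyB n f

theorem allB_iff (n : ℕ) (f : ℕ → Bool) : allB n f = true ↔ ∀ m < n, f m = true := by
  induction n with
  | zero => simp [allB]
  | succ n ih =>
    simp only [allB, Bool.and_eq_true, ih]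
    constructor
    · rintro ⟨h1, h2⟩ m hm
      rcases Nat.lt_succ_iff_lt_or_eq.1 hm with h | rfl
      · exact h2 m h
      · exact h1
    · intro h
      exact ⟨h n (by omega), fun m hm => h m (by omega)⟩

theorem anyB_imp (n : ℕ) (f : ℕ → Bool) : anyB n f = true → ∃ m < n, f m = true := by
  induction n with
  | zero => simp [anyB]
  | succ n ih =>
    simp only [anyB, Bool.or_eq_true]
    rintro (h | h)
    · exact ⟨n, by omega, h⟩
    · obtain ⟨m, hm, h⟩ := ih h
      exact ⟨m, by omega, h⟩

/-- Forces the evaluation of an argument. -/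
def forceN (n : ℕ) (f : ℕ → Bool) : Bool :=
  match n with
  | 0 => f 0
  | m + 1 => f (m + 1)
def forceI (z : ℤ) (f : ℤ → Bool) : Bool :=
  match z with
  | Int.ofNat n => forceN n fun n => f (Int.ofNat n)
  | Int.negSucc n => forceN n fun n => f (Int.negSucc n)

theorem forceN_eq (n : ℕ) (f : ℕ → Bool) : forceN n f = f n := by cases n <;> rfl
theorem forceI_eq (z : ℤ) (f : ℤ → Bool) : forceI z f = f z := by
  cases z <;> simp [forceI, forceN_eq]

def inB (i j k l m : ℕ) : Bool := Nat.beq m i || (Nat.beq m j || (Nat.beq m k || Nat.beq m l))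

def sgnB (g : ℕ → ℤ) (i j k l : ℕ) (e : ℤ) : Bool :=
  allB 15 fun m => bif inB i j k l m then decide (e * g m = 0) else decide (0 < e * g m)

def badB (g : ℕ → ℤ) (i j k l : ℕ) : Bool :=
  (anyB 15 (fun m => !inB i j k l m && decide (g m ≤ 0)) &&
    anyB 15 (fun m => !inB i j k l m && decide (0 < g m))) ||
  (anyB 15 (fun m => !inB i j k l m && decide (0 ≤ g m)) &&
    anyB 15 (fun m => !inB i j k l m && decide (g m < 0)))

def testG (g : ℕ → ℤ) (i j k l : ℕ) : Bool :=
  bif memB flN i j k l then sgnB g i j k l 1 || sgnB g i j k l (-1)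
  else memB dlN i j k l || badB g i j k l

def testB (i j k l : ℕ) : Bool :=
  forceI (nX i j k l) fun a => forceI (nY i j k l) fun b => forceI (nZ i j k l) fun c =>
  forceI (nW i j k l) fun d =>
    testG (fun m => a * (cX m - cX i) + b * (cY m - cY i) + c * (cZ m - cZ i)
      + d * (cW m - cW i)) i j k l

theorem testB_eq (i j k l : ℕ) : testB i j k l = testG (dd i j k l) i j k l := by
  simp only [testB, forceI_eq]
  rfl

set_option maxRecDepth 100000 in
theorem all_test : (allB 15 fun l => allB l fun k => allB k fun j => allB j fun i =>
    testB i j k l) = true := by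
  decide +kernel

def outP (i j k l m : Fin 15) : Prop := m ≠ i ∧ m ≠ j ∧ m ≠ k ∧ m ≠ l

def badP (i j k l : Fin 15) : Prop :=
  ((∃ m, outP i j k l m ∧ dd i j k l m ≤ 0) ∧ (∃ m, outP i j k l m ∧ 0 < dd i j k l m)) ∨
  ((∃ m, outP i j k l m ∧ 0 ≤ dd i j k l m) ∧ (∃ m, outP i j k l m ∧ dd i j k l m < 0))

theorem out_of (i j k l : Fin 15) (p : ℤ → Prop) [DecidablePred p]
    (h : anyB 15 (fun m => !inB i j k l m && decide (p (dd i j k l m))) = true) :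
    ∃ m, outP i j k l m ∧ p (dd i j k l m) := by
  obtain ⟨m, hm, h⟩ := anyB_imp _ _ h
  simp only [inB, Bool.and_eq_true, Bool.not_eq_true', Bool.or_eq_false_iff, decide_eq_true_eq] at h
  refine ⟨⟨m, hm⟩, ?_, h.2⟩
  obtain ⟨⟨h1, h2, h3, h4⟩, -⟩ := h
  have e : ∀ x : Fin 15, Nat.beq m x = false → (⟨m, hm⟩ : Fin 15) ≠ x := by
    rintro x hx rfl
    simp at hx
  exact ⟨e _ h1, e _ h2, e _ h3, e _ h4⟩

theorem test_at (i j k l : Fin 15) (hij : i < j) (hjk : j < k) (hkl : k < l) :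
    testG (dd i j k l) i j k l = true := by
  have h := all_test
  rw [allB_iff] at h
  have h := h l l.2
  rw [allB_iff] at h
  have h := h k hkl
  rw [allB_iff] at h
  have h := h j hjk
  rw [allB_iff] at h
  have h := h i hij
  rwa [testB_eq] at h

theorem memB_fl (i j k l : Fin 15) : memB flN i j k l = true ↔ (i, j, k, l) ∈ fl := by
  rw [memB_iff, flN_eq]
  exact List.mem_map_of_injective toN_inj (a := (i, j, k, l))

theorem memB_dl (i j k l : Fin 15) : memB dlN i j k l = true ↔ (i, j, k, l) ∈ dl := by
  rw [memB_iff, dlN_eq]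
  exact List.mem_map_of_injective toN_inj (a := (i, j, k, l))

theorem all_quads (i j : Fin 15) (hij : i < j) (k : Fin 15) (hjk : j < k) (l : Fin 15)
    (hkl : k < l) : (i, j, k, l) ∈ fl ∨ (i, j, k, l) ∈ dl ∨ badP i j k l := by
  have h := test_at i j k l hij hjk hkl
  by_cases hf : (i, j, k, l) ∈ fl
  · exact Or.inl hf
  · right
    have hf' : memB flN i j k l = false := by
      rw [← Bool.not_eq_true, memB_fl]; exact hf
    simp only [testG, hf', cond_false, Bool.or_eq_true, memB_dl] at h
    refine h.imp id ?_
    intro h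
    simp only [badB, Bool.or_eq_true, Bool.and_eq_true] at h
    refine h.imp (fun h => ?_) (fun h => ?_)
    · exact ⟨out_of i j k l (fun z => z ≤ 0) h.1, out_of i j k l (fun z => 0 < z) h.2⟩
    · exact ⟨out_of i j k l (fun z => 0 ≤ z) h.1, out_of i j k l (fun z => z < 0) h.2⟩

theorem facets_eq : ∀ S, S ∈ facetsE6 ↔ ∃ t ∈ fl, S = q4 t := by
  intro S
  simp only [facetsE6, fl, q4, List.mem_cons, List.not_mem_nil, or_false, Finset.mem_insert,
    Finset.mem_singleton, or_and_right, exists_or, exists_eq_left]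

def sgnP (e : ℤ) (i j k l : Fin 15) : Prop :=
  ∀ m, (m ∈ q4 (i, j, k, l) → e * dd i j k l m = 0) ∧ (m ∉ q4 (i, j, k, l) → 0 < e * dd i j k l m)

theorem sgn_of (e : ℤ) (i j k l : Fin 15) (h : sgnB (dd i j k l) i j k l e = true) :
    sgnP e i j k l := by
  intro m
  rw [sgnB, allB_iff] at h
  have h := h m m.2
  have hq : m ∈ q4 (i, j, k, l) ↔ inB i j k l m = true := by
    simp [q4, inB, Fin.ext_iff]
  rw [hq]
  cases hb : inB i j k l m <;> simpa [hb] using h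

theorem fl_sorted : ∀ t ∈ fl, t.1 < t.2.1 ∧ t.2.1 < t.2.2.1 ∧ t.2.2.1 < t.2.2.2 := by
  have h : (fl.all fun t => decide (t.1 < t.2.1) && (decide (t.2.1 < t.2.2.1) &&
      decide (t.2.2.1 < t.2.2.2))) = true := by decide +kernel
  intro t ht
  simpa using List.all_eq_true.1 h t ht

theorem facets_ok : ∀ t ∈ fl,
    sgnP 1 t.1 t.2.1 t.2.2.1 t.2.2.2 ∨ sgnP (-1) t.1 t.2.1 t.2.2.1 t.2.2.2 := by
  rintro ⟨i, j, k, l⟩ ht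
  obtain ⟨h1, h2, h3⟩ := fl_sorted _ ht
  have h := test_at i j k l h1 h2 h3
  simp only [testG, (memB_fl i j k l).2 ht, cond_true, Bool.or_eq_true] at h
  exact h.imp (sgn_of _ _ _ _ _) (sgn_of _ _ _ _ _)

theorem plucker {R : Type*} [CommRing R] (a b c d x1 y1 z1 w1 x2 y2 z2 w2 x3 y3 z3 w3 x4 y4 z4 w4
    x5 y5 z5 w5 : R)
    (h1 : a * x1 + b * y1 + c * z1 + d * w1 = 0)
    (h2 : a * x2 + b * y2 + c * z2 + d * w2 = 0)
    (h3 : a * x3 + b * y3 + c * z3 + d * w3 = 0) :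
    (a * x4 + b * y4 + c * z4 + d * w4) *
      (-d3 y1 z1 w1 y2 z2 w2 y3 z3 w3 * x5 + d3 x1 z1 w1 x2 z2 w2 x3 z3 w3 * y5
        + -d3 x1 y1 w1 x2 y2 w2 x3 y3 w3 * z5 + d3 x1 y1 z1 x2 y2 z2 x3 y3 z3 * w5) =
    (a * x5 + b * y5 + c * z5 + d * w5) *
      (-d3 y1 z1 w1 y2 z2 w2 y3 z3 w3 * x4 + d3 x1 z1 w1 x2 z2 w2 x3 z3 w3 * y4
        + -d3 x1 y1 w1 x2 y2 w2 x3 y3 w3 * z4 + d3 x1 y1 z1 x2 y2 z2 x3 y3 z3 * w4) := by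
  linear_combination
    (norm := (unfold d3; ring1))
     (-d3 y2 z2 w2 y3 z3 w3 y4 z4 w4 * x5 + d3 x2 z2 w2 x3 z3 w3 x4 z4 w4 * y5 - d3 x2 y2 w2 x3 y3 w3 x4 y4 w4 * z5 + d3 x2 y2 z2 x3 y3 z3 x4 y4 z4 * w5) * h1
    + (-1) * (-d3 y1 z1 w1 y3 z3 w3 y4 z4 w4 * x5 + d3 x1 z1 w1 x3 z3 w3 x4 z4 w4 * y5 - d3 x1 y1 w1 x3 y3 w3 x4 y4 w4 * z5 + d3 x1 y1 z1 x3 y3 z3 x4 y4 z4 * w5) * h2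
    +  (-d3 y1 z1 w1 y2 z2 w2 y4 z4 w4 * x5 + d3 x1 z1 w1 x2 z2 w2 x4 z4 w4 * y5 - d3 x1 y1 w1 x2 y2 w2 x4 y4 w4 * z5 + d3 x1 y1 z1 x2 y2 z2 x4 y4 z4 * w5) * h3

theorem VE6_0 : ∀ i : Fin 15, VE6 0 i = (cX i : ℝ) := by
  intro i
  have h : cX i = (![4, -4, 2, 2, -4, -4, 0, 2, -4, 2, -1, 4, -2, 0, -2] : Fin 15 → ℤ) i := by
    revert i; decide +kernel
  rw [h]
  fin_cases i <;> simp [VE6]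
theorem VE6_1 : ∀ i : Fin 15, VE6 1 i = (cY i : ℝ) := by
  intro i
  have h : cY i = (![0, -4, -4, 2, 4, 2, -4, 2, 2, -4, -1, -1, 0, 4, 0] : Fin 15 → ℤ) i := by
    revert i; decide +kernel
  rw [h]
  fin_cases i <;> simp [VE6]
theorem VE6_2 : ∀ i : Fin 15, VE6 2 i = (cZ i : ℝ) := by
  intro i
  have h : cZ i = (![0, 0, 4, -4, 0, -4, 0, 4, 4, -4, 0, 0, 4, 0, -4] : Fin 15 → ℤ) i := by
    revert i; decide +kernel
  rw [h]
  fin_cases i <;> simp [VE6]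
theorem VE6_3 : ∀ i : Fin 15, VE6 3 i = (cW i : ℝ) := by
  intro i
  have h : cW i = (![0, 0, 0, 4, 3, -4, 4, 4, -4, 0, -3, 3, 1, 0, 1] : Fin 15 → ℤ) i := by
    revert i; decide +kernel
  rw [h]
  fin_cases i <;> simp [VE6]

theorem F_eq (a : Fin 4 → ℝ) (c : ℝ) (i : Fin 15) : (∑ k : Fin 4, a k * VE6 k i) + c =
    a 0 * cX i + a 1 * cY i + a 2 * cZ i + a 3 * cW i + c := by
  rw [Fin.sum_univ_four, VE6_0, VE6_1, VE6_2, VE6_3]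

def FF (a : Fin 4 → ℝ) (c : ℝ) (i : Fin 15) : ℝ :=
  a 0 * cX i + a 1 * cY i + a 2 * cZ i + a 3 * cW i + c

theorem FF_dd (a : Fin 4 → ℝ) (c : ℝ) (i j k l m n : Fin 15) (hi : FF a c i = 0)
    (hj : FF a c j = 0) (hk : FF a c k = 0) (hl : FF a c l = 0) :
    FF a c m * (dd i j k l n : ℝ) = FF a c n * (dd i j k l m : ℝ) := by
  have E : ∀ p, FF a c p = a 0 * ((cX p : ℝ) - cX i) + a 1 * ((cY p : ℝ) - cY i)
      + a 2 * ((cZ p : ℝ) - cZ i) + a 3 * ((cW p : ℝ) - cW i) := by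
    intro p; unfold FF at *; linear_combination hi
  rw [E] at hj hk hl
  rw [E m, E n]
  have := plucker _ _ _ _ _ _ _ _ _ _ _ _ _ _ _ _ ((cX m : ℝ) - cX i) ((cY m : ℝ) - cY i)
    ((cZ m : ℝ) - cZ i) ((cW m : ℝ) - cW i) ((cX n : ℝ) - cX i) ((cY n : ℝ) - cY i)
    ((cZ n : ℝ) - cZ i) ((cW n : ℝ) - cW i) hj hk hl
  simp only [dd, nX, nY, nZ, nW]
  unfold d3 at *
  push_cast
  exact this

theorem bad_false (a : Fin 4 → ℝ) (c : ℝ) (i j k l : Fin 15) (hi : FF a c i = 0)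
    (hj : FF a c j = 0) (hk : FF a c k = 0) (hl : FF a c l = 0)
    (hp : ∀ m, outP i j k l m → 0 < FF a c m) : ¬ badP i j k l := by
  rintro (⟨⟨m, hm, h1⟩, ⟨n, hn, h2⟩⟩ | ⟨⟨m, hm, h1⟩, ⟨n, hn, h2⟩⟩)
  all_goals
    have e := FF_dd a c i j k l m n hi hj hk hl
    have pm := hp m hm
    have pn := hp n hn
  · have h1' : (dd i j k l m : ℝ) ≤ 0 := by exact_mod_cast h1
    have h2' : (0 : ℝ) < dd i j k l n := by exact_mod_cast h2
    have := mul_pos pm h2'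
    have := mul_nonpos_of_nonneg_of_nonpos pn.le h1'
    linarith
  · have h1' : (0 : ℝ) ≤ dd i j k l m := by exact_mod_cast h1
    have h2' : (dd i j k l n : ℝ) < 0 := by exact_mod_cast h2
    have := mul_neg_of_pos_of_neg pm h2'
    have := mul_nonneg pn.le h1'
    linarith

theorem FF_all (a : Fin 4 → ℝ) (c : ℝ) :
    FF a c 0 = a 0 * (4) + a 1 * (0) + a 2 * (0) + a 3 * (0) + c ∧
    FF a c 1 = a 0 * (-4) + a 1 * (-4) + a 2 * (0) + a 3 * (0) + c ∧
    FF a c 2 = a 0 * (2) + a 1 * (-4) + a 2 * (4) + a 3 * (0) + c ∧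
    FF a c 3 = a 0 * (2) + a 1 * (2) + a 2 * (-4) + a 3 * (4) + c ∧
    FF a c 4 = a 0 * (-4) + a 1 * (4) + a 2 * (0) + a 3 * (3) + c ∧
    FF a c 5 = a 0 * (-4) + a 1 * (2) + a 2 * (-4) + a 3 * (-4) + c ∧
    FF a c 6 = a 0 * (0) + a 1 * (-4) + a 2 * (0) + a 3 * (4) + c ∧
    FF a c 7 = a 0 * (2) + a 1 * (2) + a 2 * (4) + a 3 * (4) + c ∧
    FF a c 8 = a 0 * (-4) + a 1 * (2) + a 2 * (4) + a 3 * (-4) + c ∧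
    FF a c 9 = a 0 * (2) + a 1 * (-4) + a 2 * (-4) + a 3 * (0) + c ∧
    FF a c 10 = a 0 * (-1) + a 1 * (-1) + a 2 * (0) + a 3 * (-3) + c ∧
    FF a c 11 = a 0 * (4) + a 1 * (-1) + a 2 * (0) + a 3 * (3) + c ∧
    FF a c 12 = a 0 * (-2) + a 1 * (0) + a 2 * (4) + a 3 * (1) + c ∧
    FF a c 13 = a 0 * (0) + a 1 * (4) + a 2 * (0) + a 3 * (0) + c ∧
    FF a c 14 = a 0 * (-2) + a 1 * (0) + a 2 * (-4) + a 3 * (1) + c := by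
  refine ⟨?_, ?_, ?_, ?_, ?_, ?_, ?_, ?_, ?_, ?_, ?_, ?_, ?_, ?_, ?_⟩ <;>
    rw [FF, ← VE6_0, ← VE6_1, ← VE6_2, ← VE6_3] <;> simp [VE6]

theorem deg_false (a : Fin 4 → ℝ) (c : ℝ) (i j k l : Fin 15) (hi : FF a c i = 0)
    (hj : FF a c j = 0) (hk : FF a c k = 0) (hl : FF a c l = 0)
    (hp : ∀ m, outP i j k l m → 0 < FF a c m) : (i, j, k, l) ∉ dl := by
  intro h
  have hp' : ∀ m, m = i ∨ m = j ∨ m = k ∨ m = l ∨ 0 < FF a c m := by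
    intro m
    have := hp m
    unfold outP at this
    tauto
  obtain ⟨e0, e1, e2, e3, e4, e5, e6, e7, e8, e9, e10, e11, e12, e13, e14⟩ := FF_all a c
  simp only [dl, List.mem_cons, List.not_mem_nil, or_false, Prod.mk.injEq] at h
  rcases h with ⟨rfl, rfl, rfl, rfl⟩ | ⟨rfl, rfl, rfl, rfl⟩ | ⟨rfl, rfl, rfl, rfl⟩ | ⟨rfl, rfl, rfl, rfl⟩ | ⟨rfl, rfl, rfl, rfl⟩ | ⟨rfl, rfl, rfl, rfl⟩ | ⟨rfl, rfl, rfl, rfl⟩ | ⟨rfl, rfl, rfl, rfl⟩ | ⟨rfl, rfl, rfl, rfl⟩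
  all_goals
    have p0 := hp' 0
    have p1 := hp' 1
    have p2 := hp' 2
    have p3 := hp' 3
    have p4 := hp' 4
    have p5 := hp' 5
    have p6 := hp' 6
    have p7 := hp' 7
    have p8 := hp' 8
    have p9 := hp' 9
    have p10 := hp' 10
    have p11 := hp' 11
    have p12 := hp' 12
    have p13 := hp' 13
    have p14 := hp' 14
    simp [Fin.ext_iff] at p0 p1 p2 p3 p4 p5 p6 p7 p8 p9 p10 p11 p12 p13 p14
    simp only [e0, e1, e2, e3, e4, e5, e6, e7, e8, e9, e10, e11, e12, e13, e14] at *
    linarith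

/-- A 4-element subset `S` of the 15 column vectors of `VE6` admits an affine functional
vanishing on `S` and strictly positive on the rest if and only if `S` is one of the 45
listed facet quadruples: the convex hull of the 15 columns is a simplicial 4-polytope
whose 45 facets are exactly these quadruples. -/
theorem stmt15 (S : Finset (Fin 15)) (hS : S.card = 4) :
    (∃ (a : Fin 4 → ℝ) (c : ℝ), a ≠ 0 ∧
        (∀ i ∈ S, (∑ k : Fin 4, a k * VE6 k i) + c = 0) ∧
        (∀ j ∉ S, 0 < (∑ k : Fin 4, a k * VE6 k j) + c)) ↔
      S ∈ facetsE6 := by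
  constructor
  · rintro ⟨a, c, -, h0, hp⟩
    simp only [F_eq] at h0 hp
    change ∀ i ∈ S, FF a c i = 0 at h0
    change ∀ i ∉ S, 0 < FF a c i at hp
    let e := S.orderEmbOfFin hS
    have hr : ∀ m, m ∈ S ↔ ∃ t, e t = m := by
      intro m
      have := Finset.range_orderEmbOfFin S hS
      rw [← Finset.mem_coe, ← this]; rfl
    have hm : ∀ m, m ∈ S ↔ m = e 0 ∨ m = e 1 ∨ m = e 2 ∨ m = e 3 := by
      intro m
      rw [hr, Fin.exists_fin_succ, Fin.exists_fin_succ, Fin.exists_fin_succ, Fin.exists_fin_succ]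
      simp [eq_comm]
    have z : ∀ t, FF a c (e t) = 0 := fun t => h0 _ ((hr _).2 ⟨t, rfl⟩)
    have hp' : ∀ m, outP (e 0) (e 1) (e 2) (e 3) m → 0 < FF a c m := by
      intro m h
      apply hp
      rw [hm]
      unfold outP at h
      tauto
    have lt : ∀ s t : Fin 4, s < t → e s < e t := fun s t h => e.strictMono h
    rcases all_quads (e 0) (e 1) (lt _ _ (by decide)) (e 2) (lt _ _ (by decide)) (e 3)
      (lt _ _ (by decide)) with h | h | h
    · rw [facets_eq]
      refine ⟨_, h, ?_⟩
      ext m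
      rw [hm]
      simp [q4]
    · exact absurd h (deg_false a c _ _ _ _ (z 0) (z 1) (z 2) (z 3) hp')
    · exact absurd h (bad_false a c _ _ _ _ (z 0) (z 1) (z 2) (z 3) hp')
  · intro h
    obtain ⟨t, ht, rfl⟩ := (facets_eq S).1 h
    obtain ⟨i, j, k, l⟩ := t
    have key : ∀ e : ℤ, sgnP e i j k l → ∃ (a : Fin 4 → ℝ) (c : ℝ), a ≠ 0 ∧
        (∀ m ∈ q4 (i, j, k, l), (∑ k : Fin 4, a k * VE6 k m) + c = 0) ∧
        (∀ m ∉ q4 (i, j, k, l), 0 < (∑ k : Fin 4, a k * VE6 k m) + c) := by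
      intro e he
      let a : Fin 4 → ℝ := ![((e * nX i j k l : ℤ) : ℝ), ((e * nY i j k l : ℤ) : ℝ),
        ((e * nZ i j k l : ℤ) : ℝ), ((e * nW i j k l : ℤ) : ℝ)]
      let c : ℝ := -((e * (nX i j k l * cX i + nY i j k l * cY i + nZ i j k l * cZ i
        + nW i j k l * cW i) : ℤ) : ℝ)
      have E : ∀ m, (∑ k : Fin 4, a k * VE6 k m) + c = ((e * dd i j k l m : ℤ) : ℝ) := by
        intro m
        rw [F_eq]
        simp only [a, c, dd, Matrix.cons_val]
        push_cast
        ring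
      have h0 : ∀ m ∈ q4 (i, j, k, l), (∑ k : Fin 4, a k * VE6 k m) + c = 0 := by
        intro m hm
        rw [E, (he m).1 hm, Int.cast_zero]
      have h1 : ∀ m ∉ q4 (i, j, k, l), 0 < (∑ k : Fin 4, a k * VE6 k m) + c := by
        intro m hm
        rw [E]
        exact_mod_cast (he m).2 hm
      refine ⟨a, c, ?_, h0, h1⟩
      intro ha
      have hi := h0 i (by simp [q4])
      obtain ⟨m, hm⟩ : ∃ m, m ∉ q4 (i, j, k, l) := by
        by_contra! hc
        have : (Finset.univ : Finset (Fin 15)) = q4 (i, j, k, l) := by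
          ext m; simp [hc m]
        rw [← this] at hS
        simp at hS
      have hq := h1 m hm
      simp only [ha, Pi.zero_apply, zero_mul, Finset.sum_const_zero, zero_add] at hi hq
      linarith
    rcases facets_ok _ ht with h | h
    · exact key _ h
    · exact key _ h
end
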